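/- (Theorem 2: local continuity of the value function.) Let Assumptions 1–4 hold, let (x_s,u_s)∈Z be a steady-state (f(x_s,u_s)=x_s, h_s:=h(x_s,u_s)≤0 componentwise), and assume the value function infimum is attained by a unique minimizer for every horizon and every initial condition in X×𝕳. Then there exist N₂∈ℕ and γ_v∈K∞ such that for all δ∈(0,δ_c], all E∈(0,E_h], all N≥N₂, all x with ‖x−x_s‖≤δ and all H∈𝕳 with ‖H−H^s‖₁≤E: |J*_N(x,H) − J*_N(x_s,H^s)| ≤ γ_v(δ+E). -/

import Mathlib

open Finset Filter
open scoped Classical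

noncomputable section

namespace EMPC

abbrev Vec (n : ℕ) : Type := EuclideanSpace ℝ (Fin n)

variable {n m p : ℕ}

/-- Trajectory of the discrete-time system `x(k+1) = f(x(k), u(k))`. -/
def traj (f : Vec n → Vec m → Vec n) (x : Vec n) (u : ℕ → Vec m) : ℕ → Vec n
  | 0 => x
  | k + 1 => f (traj f x u k) (u k)

/-- Open-loop cost `J_N(x,u)`. -/
def cost (f : Vec n → Vec m → Vec n) (ℓ : Vec n → Vec m → ℝ) (x : Vec n)
    (u : ℕ → Vec m) (N : ℕ) : ℝ :=
  ∑ k ∈ Finset.range N, ℓ (traj f x u k) (u k)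

/-- Admissibility `u ∈ U^N(x,H)` for the transient average constrained problem. -/
def Admissible (f : Vec n → Vec m → Vec n) (h : Vec n → Vec m → Vec p)
    (Z : Set (Vec n × Vec m)) (T N : ℕ) (x : Vec n) (H : ℕ → Vec p)
    (u : ℕ → Vec m) : Prop :=
  (∀ k < N, (traj f x u k, u k) ∈ Z) ∧
  (∀ j ∈ Finset.Icc 1 (T - 1), ∀ i : Fin p,
    (∑ l ∈ Finset.Icc j (T - 1), H l i)
      + ∑ k ∈ Finset.range j, h (traj f x u k) (u k) i ≤ 0) ∧
  (∀ s : ℕ, s + T ≤ N → ∀ i : Fin p,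
    ∑ k ∈ Finset.Ico s (s + T), h (traj f x u k) (u k) i ≤ 0)

/-- Class `K∞` comparison functions. -/
def KInf (α : ℝ → ℝ) : Prop :=
  ContinuousOn α (Set.Ici 0) ∧ StrictMonoOn α (Set.Ici 0) ∧ α 0 = 0 ∧
    Tendsto α atTop atTop

/-- Class `L_ℕ`: decreasing functions on ℕ with limit 0. -/
def LN (δ : ℕ → ℝ) : Prop :=
  Antitone δ ∧ (∀ k, 0 ≤ δ k) ∧ Tendsto δ atTop (nhds 0)

/-- Class `KLS`. -/
def KLS (β : ℝ → ℕ → ℝ) : Prop :=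
  (∀ k : ℕ, ContinuousOn (fun r => β r k) (Set.Ici 0) ∧
    StrictMonoOn (fun r => β r k) (Set.Ici 0) ∧ β 0 k = 0) ∧
  (∀ r : ℝ, 0 ≤ r → LN (fun k => β r k)) ∧
  (∀ r : ℝ, 0 ≤ r → Summable (fun k => β r k)) ∧
  (ContinuousOn (fun r => ∑' k, β r k) (Set.Ici 0) ∧
    StrictMonoOn (fun r => ∑' k, β r k) (Set.Ici 0) ∧ (∑' k, β 0 k) = 0)

/-- Class `KL`. -/
def KLcl (β : ℝ → ℝ → ℝ) : Prop :=
  ContinuousOn (fun q : ℝ × ℝ => β q.1 q.2) (Set.Ici 0 ×ˢ Set.Ici 0) ∧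
  (∀ s : ℝ, 0 ≤ s → StrictMonoOn (fun r => β r s) (Set.Ici 0) ∧ β 0 s = 0) ∧
  (∀ r : ℝ, 0 ≤ r → AntitoneOn (fun s => β r s) (Set.Ici 0) ∧
    Tendsto (fun s => β r s) atTop (nhds 0)) ∧
  (∀ r s : ℝ, 0 ≤ r → 0 ≤ s → 0 ≤ β r s)

/-- ℓ¹-norm of a vector. -/
def l1 (v : Vec p) : ℝ := ∑ i, |v i|

/-- `Ĥ_k = Σ_i max{H_{ik}, 0}`. -/
def hatCol (H : ℕ → Vec p) (k : ℕ) : ℝ := ∑ i, max (H k i) 0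

/-- Norm-like measure `⟨H⟩ = max_{k ∈ {1,…,T-1}} Ĥ_k`. -/
def measH (T : ℕ) (H : ℕ → Vec p) : ℝ := ⨆ k ∈ Finset.Icc 1 (T - 1), hatCol H k

/-- `‖H‖₁ = max_{k ∈ {1,…,T-1}} ‖H_k‖₁`. -/
def norm1H (T : ℕ) (H : ℕ → Vec p) : ℝ := ⨆ k ∈ Finset.Icc 1 (T - 1), l1 (H k)

/-- The set `𝕳` of feasible stored outputs. -/
def HSet (h : Vec n → Vec m → Vec p) (Z : Set (Vec n × Vec m)) (T : ℕ) :
    Set (ℕ → Vec p) :=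
  {H | ∀ k ∈ Finset.Icc 1 (T - 1), ∀ i : Fin p,
    sInf ((fun z : Vec n × Vec m => h z.1 z.2 i) '' Z) ≤ H k i ∧
    H k i ≤ sSup ((fun z : Vec n × Vec m => h z.1 z.2 i) '' Z)}

/-- Value function `J*_N(x,H)`. -/
def Jstar (f : Vec n → Vec m → Vec n) (ℓ : Vec n → Vec m → ℝ)
    (h : Vec n → Vec m → Vec p) (Z : Set (Vec n × Vec m)) (T N : ℕ)
    (x : Vec n) (H : ℕ → Vec p) : ℝ :=
  sInf ((fun u => cost f ℓ x u N) '' {u | Admissible f h Z T N x H u})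

/-- Rotated stage cost `ℓ̃`. -/
def rot (f : Vec n → Vec m → Vec n) (ℓ : Vec n → Vec m → ℝ)
    (h : Vec n → Vec m → Vec p) (ℓs : ℝ) (lam : Vec n → ℝ) (lb : Vec p)
    (x : Vec n) (u : Vec m) : ℝ :=
  ℓ x u - ℓs + lam x - lam (f x u) + ∑ i, lb i * h x u i

/-- Rotated open-loop cost. -/
def rcost (f : Vec n → Vec m → Vec n) (ℓ : Vec n → Vec m → ℝ)
    (h : Vec n → Vec m → Vec p) (ℓs : ℝ) (lam : Vec n → ℝ) (lb : Vec p)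
    (x : Vec n) (u : ℕ → Vec m) (N : ℕ) : ℝ :=
  ∑ k ∈ Finset.range N, rot f ℓ h ℓs lam lb (traj f x u k) (u k)

/-- Rotated value function `J̃*_N(x,H)`. -/
def Jtstar (f : Vec n → Vec m → Vec n) (ℓ : Vec n → Vec m → ℝ)
    (h : Vec n → Vec m → Vec p) (Z : Set (Vec n × Vec m)) (T : ℕ)
    (ℓs : ℝ) (lam : Vec n → ℝ) (lb : Vec p) (N : ℕ)
    (x : Vec n) (H : ℕ → Vec p) : ℝ :=
  sInf ((fun u => rcost f ℓ h ℓs lam lb x u N) '' {u | Admissible f h Z T N x H u})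

/-- `k_{T,N} = ⌈N/T⌉·T − N`. -/
def kTN (T N : ℕ) : ℕ := ((N + T - 1) / T) * T - N

/-- The stored-output matrix along a trajectory, starting at time `d`
(column `k ∈ {1,…,T-1}` is the auxiliary output at time `d + k - 1`). -/
def storedH (f : Vec n → Vec m → Vec n) (h : Vec n → Vec m → Vec p)
    (x : Vec n) (u : ℕ → Vec m) (d : ℕ) : ℕ → Vec p :=
  fun k => h (traj f x u (d + k - 1)) (u (d + k - 1))

/-- Local controllability (Assumption 4). -/
def LocCtrl (f : Vec n → Vec m → Vec n) (h : Vec n → Vec m → Vec p)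
    (Z : Set (Vec n × Vec m)) (T : ℕ) (xs : Vec n) (δc Eh : ℝ) (d : ℕ)
    (γx γu : ℝ → ℝ) : Prop :=
  ∀ (xc : Vec n) (Hc : ℕ → Vec p) (uc : ℕ → Vec m),
    Admissible f h Z T (d + T) xc Hc uc →
    measH T Hc ≤ Eh →
    (∀ k ≤ d + T, ‖traj f xc uc k - xs‖ ≤ δc) →
    ∀ (N₁ : ℕ) (x₁ : Vec n) (H₁ : ℕ → Vec p) (u₁ : ℕ → Vec m),
      d + T ≤ N₁ → x₁ ∈ Prod.fst '' Z → H₁ ∈ HSet h Z T →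
      Admissible f h Z T N₁ x₁ H₁ u₁ →
      measH T (fun k => storedH f h x₁ u₁ d k - storedH f h xc uc d k) ≤ Eh →
      ‖traj f x₁ u₁ d - xs‖ ≤ δc →
      ∀ (x₂ : Vec n) (H₂ : ℕ → Vec p),
        ‖x₂ - xs‖ ≤ δc → measH T (fun k => H₂ k - Hc k) ≤ Eh →
        ∃ u₂ : ℕ → Vec m,
          Admissible f h Z T d x₂ H₂ u₂ ∧
          traj f x₂ u₂ d = traj f x₁ u₁ d ∧
          Admissible f h Z T N₁ x₂ H₂ (fun k => if k < d then u₂ k else u₁ k) ∧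
          ∀ k ≤ d,
            ‖traj f x₂ u₂ k - traj f xc uc k‖ ≤
              γx (max (‖x₂ - xc‖ + measH T (fun j => H₂ j - Hc j))
                (‖traj f x₁ u₁ d - traj f xc uc d‖ +
                  measH T (fun j => storedH f h x₁ u₁ d j - storedH f h xc uc d j))) ∧
            ‖u₂ k - uc k‖ ≤
              γu (max (‖x₂ - xc‖ + measH T (fun j => H₂ j - Hc j))
                (‖traj f x₁ u₁ d - traj f xc uc d‖ +
                  measH T (fun j => storedH f h x₁ u₁ d j - storedH f h xc uc d j)))

/-- Shift dynamics of the stored outputs: `f_H(H, y) = [H_2, …, H_{T-1}, y]`. -/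
def shiftH (T : ℕ) (H : ℕ → Vec p) (y : Vec p) : ℕ → Vec p :=
  fun k => if k + 1 < T then H (k + 1) else if k + 1 = T then y else H k

/-- Closed-loop trajectory of the extended state `χ = (x, H)` under the MPC
feedback `μ_N(x,H) = u*_{N,x,H}(0)`. -/
def clTraj (f : Vec n → Vec m → Vec n) (h : Vec n → Vec m → Vec p)
    (ustar : ℕ → Vec n → (ℕ → Vec p) → ℕ → Vec m) (N T : ℕ)
    (χ : Vec n × (ℕ → Vec p)) : ℕ → Vec n × (ℕ → Vec p)
  | 0 => χ
  | k + 1 =>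
    (f (clTraj f h ustar N T χ k).1
        (ustar N (clTraj f h ustar N T χ k).1 (clTraj f h ustar N T χ k).2 0),
      shiftH T (clTraj f h ustar N T χ k).2
        (h (clTraj f h ustar N T χ k).1
          (ustar N (clTraj f h ustar N T χ k).1 (clTraj f h ustar N T χ k).2 0)))

theorem traj_congr (f : Vec n → Vec m → Vec n) (x : Vec n) (u v : ℕ → Vec m) (K : ℕ)
    (huv : ∀ k < K, u k = v k) : traj f x u K = traj f x v K := by
  induction K with
  | zero => rfl
  | succ K ih =>
    simp only [traj]
    rw [ih (fun k hk => huv k (by omega)), huv K (by omega)]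

theorem traj_add (f : Vec n → Vec m → Vec n) (x : Vec n) (u : ℕ → Vec m) (a k : ℕ) :
    traj f x u (a + k) = traj f (traj f x u a) (fun i => u (a + i)) k := by
  induction k with
  | zero => rfl
  | succ k ih =>
    rw [← add_assoc]
    simp only [traj]
    rw [ih]

theorem cost_add (f : Vec n → Vec m → Vec n) (ℓ : Vec n → Vec m → ℝ) (x : Vec n)
    (u : ℕ → Vec m) (a b : ℕ) :
    cost f ℓ x u (a + b) = cost f ℓ x u a
      + cost f ℓ (traj f x u a) (fun i => u (a + i)) b := by
  unfold cost
  rw [Finset.sum_range_add]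
  simp only [traj_add]

theorem cost_congr (f : Vec n → Vec m → Vec n) (ℓ : Vec n → Vec m → ℝ) (x : Vec n)
    (u v : ℕ → Vec m) (K : ℕ) (huv : ∀ k < K, u k = v k) :
    cost f ℓ x u K = cost f ℓ x v K := by
  unfold cost
  refine Finset.sum_congr rfl fun k hk => ?_
  have hk' := Finset.mem_range.1 hk
  rw [traj_congr f x u v k (fun i hi => huv i (by omega)), huv k hk']

theorem cost_cat (f : Vec n → Vec m → Vec n) (ℓ : Vec n → Vec m → ℝ) (x₁ x₂ : Vec n)
    (u₁ u₂ : ℕ → Vec m) (d N : ℕ) (hd : d ≤ N) (hx : traj f x₂ u₂ d = traj f x₁ u₁ d) :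
    cost f ℓ x₂ (fun k => if k < d then u₂ k else u₁ k) N
      = cost f ℓ x₁ u₁ N - cost f ℓ x₁ u₁ d + cost f ℓ x₂ u₂ d := by
  obtain ⟨b, rfl⟩ := Nat.exists_eq_add_of_le hd
  rw [cost_add, cost_add]
  have h1 : traj f x₂ (fun k => if k < d then u₂ k else u₁ k) d = traj f x₂ u₂ d :=
    traj_congr _ _ _ _ _ (fun k hk => by simp [hk])
  have h2 : cost f ℓ x₂ (fun k => if k < d then u₂ k else u₁ k) d = cost f ℓ x₂ u₂ d :=
    cost_congr _ _ _ _ _ _ (fun k hk => by simp [hk])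
  rw [h1, h2, hx]
  have h3 : (fun i => if d + i < d then u₂ (d + i) else u₁ (d + i)) = fun i => u₁ (d + i) := by
    funext i; simp
  rw [h3]; ring

theorem Admissible.mono {f : Vec n → Vec m → Vec n} {h : Vec n → Vec m → Vec p}
    {Z : Set (Vec n × Vec m)} {T N N' : ℕ} {x : Vec n} {H : ℕ → Vec p} {u : ℕ → Vec m}
    (hu : Admissible f h Z T N x H u) (hN : N' ≤ N) : Admissible f h Z T N' x H u :=
  ⟨fun k hk => hu.1 k (by omega), hu.2.1, fun s hs => hu.2.2 s (by omega)⟩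

theorem hatCol_nonneg (H : ℕ → Vec p) (k : ℕ) : 0 ≤ hatCol H k :=
  Finset.sum_nonneg fun _ _ => le_max_right _ _

theorem measH_nonneg (T : ℕ) (H : ℕ → Vec p) : 0 ≤ measH T H :=
  Real.iSup_nonneg fun k => Real.iSup_nonneg fun _ => hatCol_nonneg H k

theorem measH_le {T : ℕ} {H : ℕ → Vec p} {c : ℝ} (hc : 0 ≤ c)
    (hH : ∀ k ∈ Finset.Icc 1 (T - 1), hatCol H k ≤ c) : measH T H ≤ c :=
  Real.iSup_le (fun k => Real.iSup_le (fun hk => hH k hk) hc) hc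

theorem l1_nonneg (v : Vec p) : 0 ≤ l1 v := Finset.sum_nonneg fun _ _ => abs_nonneg _

theorem le_norm1H (T : ℕ) (H : ℕ → Vec p) (k : ℕ) (hk : k ∈ Finset.Icc 1 (T - 1)) :
    l1 (H k) ≤ norm1H T H := by
  unfold norm1H
  have h0 : ∀ j, (⨆ (_ : j ∈ Finset.Icc 1 (T - 1)), l1 (H j))
      ≤ ∑ i ∈ Finset.Icc 1 (T - 1), l1 (H i) := by
    intro j
    refine Real.iSup_le (fun hj => ?_) (Finset.sum_nonneg fun _ _ => l1_nonneg _)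
    exact Finset.single_le_sum (f := fun i => l1 (H i)) (fun _ _ => l1_nonneg _) hj
  have hb : BddAbove (Set.range fun j => ⨆ (_ : j ∈ Finset.Icc 1 (T - 1)), l1 (H j)) :=
    ⟨_, by rintro _ ⟨j, rfl⟩; exact h0 j⟩
  refine le_trans ?_ (le_ciSup hb k)
  simp [hk]

theorem hatCol_le_l1 (H : ℕ → Vec p) (k : ℕ) : hatCol H k ≤ l1 (H k) :=
  Finset.sum_le_sum fun _ _ => max_le (le_abs_self _) (abs_nonneg _)

theorem measH_zero' (T : ℕ) (H : ℕ → Vec p)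
    (hH : ∀ k ∈ Finset.Icc 1 (T - 1), ∀ i, H k i ≤ 0) : measH T H = 0 := by
  refine le_antisymm (measH_le le_rfl fun k hk => ?_) (measH_nonneg _ _)
  exact Finset.sum_nonpos fun i _ => by simp [hH k hk i]

theorem KInf.mono {α : ℝ → ℝ} (hα : KInf α) {a b : ℝ} (ha : 0 ≤ a) (hab : a ≤ b) :
    α a ≤ α b :=
  hα.2.1.monotoneOn (Set.mem_Ici.2 ha) (Set.mem_Ici.2 (ha.trans hab)) hab

theorem KInf.nonneg {α : ℝ → ℝ} (hα : KInf α) {a : ℝ} (ha : 0 ≤ a) : 0 ≤ α a := by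
  have := hα.mono le_rfl ha
  rwa [hα.2.2.1] at this

theorem KInf.pos {α : ℝ → ℝ} (hα : KInf α) {a : ℝ} (ha : 0 < a) : 0 < α a := by
  have := hα.2.1 (Set.mem_Ici.2 le_rfl) (Set.mem_Ici.2 ha.le) ha
  rwa [hα.2.2.1] at this

theorem small_of_cont {g : ℝ → ℝ} (hg : ContinuousOn g (Set.Ici 0)) (h0 : g 0 = 0)
    {ε : ℝ} (hε : 0 < ε) : ∃ r > 0, ∀ s, 0 ≤ s → s ≤ r → g s < ε := by
  have h1 := hg 0 (Set.mem_Ici.2 le_rfl)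
  rw [Metric.continuousWithinAt_iff] at h1
  obtain ⟨r, hr, h2⟩ := h1 ε hε
  refine ⟨r / 2, by positivity, fun s hs hsr => ?_⟩
  have h3 := h2 (Set.mem_Ici.2 hs) (by
    rw [Real.dist_eq, sub_zero, abs_of_nonneg hs]; linarith)
  rw [h0, Real.dist_eq, sub_zero] at h3
  exact (le_abs_self _).trans_lt h3

/-- The error function of the local controllability steps. -/
def Gf (d : ℕ) (αl γx γu : ℝ → ℝ) (r : ℝ) : ℝ := d * αl (γx r + γu r)

theorem Gf_zero {d : ℕ} {αl γx γu : ℝ → ℝ} (hl : KInf αl) (hx : KInf γx) (hu : KInf γu) :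
    Gf d αl γx γu 0 = 0 := by
  simp [Gf, hl.2.2.1, hx.2.2.1, hu.2.2.1]

theorem Gf_cont {d : ℕ} {αl γx γu : ℝ → ℝ} (hl : KInf αl) (hx : KInf γx) (hu : KInf γu) :
    ContinuousOn (Gf d αl γx γu) (Set.Ici 0) := by
  unfold Gf
  refine continuousOn_const.mul (hl.1.comp (hx.1.add hu.1) ?_)
  intro r hr
  exact Set.mem_Ici.2 (add_nonneg (hx.nonneg hr) (hu.nonneg hr))

theorem Gf_mono {d : ℕ} {αl γx γu : ℝ → ℝ} (hl : KInf αl) (hx : KInf γx) (hu : KInf γu)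
    {a b : ℝ} (ha : 0 ≤ a) (hab : a ≤ b) : Gf d αl γx γu a ≤ Gf d αl γx γu b := by
  unfold Gf
  refine mul_le_mul_of_nonneg_left ?_ (Nat.cast_nonneg _)
  exact hl.mono (add_nonneg (hx.nonneg ha) (hu.nonneg ha))
    (add_le_add (hx.mono ha hab) (hu.mono ha hab))

theorem Gf_nonneg {d : ℕ} {αl γx γu : ℝ → ℝ} (hl : KInf αl) (hx : KInf γx) (hu : KInf γu)
    {a : ℝ} (ha : 0 ≤ a) : 0 ≤ Gf d αl γx γu a := by
  have := Gf_mono (d := d) hl hx hu le_rfl ha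
  rwa [Gf_zero hl hx hu] at this

/-- Core cost estimate from local controllability. -/
theorem loc_core {f : Vec n → Vec m → Vec n} {ℓ : Vec n → Vec m → ℝ}
    {h : Vec n → Vec m → Vec p} {Z : Set (Vec n × Vec m)} {T : ℕ} {xs : Vec n}
    {δc Eh : ℝ} {d : ℕ} {γx γu αl : ℝ → ℝ} (hl : KInf αl)
    (hlc : ∀ z₁ ∈ Z, ∀ z₂ ∈ Z,
      |ℓ z₁.1 z₁.2 - ℓ z₂.1 z₂.2| ≤ αl ‖(z₁.1 - z₂.1, z₁.2 - z₂.2)‖)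
    (hγx : KInf γx) (hγu : KInf γu)
    (hloc : LocCtrl f h Z T xs δc Eh d γx γu)
    {xc : Vec n} {Hc : ℕ → Vec p} {uc : ℕ → Vec m}
    (hc : Admissible f h Z T (d + T) xc Hc uc) (hHc : measH T Hc ≤ Eh)
    (hcx : ∀ k ≤ d + T, ‖traj f xc uc k - xs‖ ≤ δc)
    {N₁ : ℕ} {x₁ : Vec n} {H₁ : ℕ → Vec p} {u₁ : ℕ → Vec m}
    (hN : d + T ≤ N₁) (hx₁ : x₁ ∈ Prod.fst '' Z) (hH₁ : H₁ ∈ HSet h Z T)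
    (hu₁ : Admissible f h Z T N₁ x₁ H₁ u₁)
    (hs : measH T (fun k => storedH f h x₁ u₁ d k - storedH f h xc uc d k) ≤ Eh)
    (hx₁d : ‖traj f x₁ u₁ d - xs‖ ≤ δc)
    {x₂ : Vec n} {H₂ : ℕ → Vec p} (hx₂ : ‖x₂ - xs‖ ≤ δc)
    (hH₂ : measH T (fun k => H₂ k - Hc k) ≤ Eh) {ζ : ℝ}
    (hζ₁ : ‖x₂ - xc‖ + measH T (fun j => H₂ j - Hc j) ≤ ζ)
    (hζ₂ : ‖traj f x₁ u₁ d - traj f xc uc d‖ +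
      measH T (fun j => storedH f h x₁ u₁ d j - storedH f h xc uc d j) ≤ ζ) :
    ∃ v : ℕ → Vec m, Admissible f h Z T N₁ x₂ H₂ v ∧
      cost f ℓ x₂ v N₁ ≤ cost f ℓ x₁ u₁ N₁ - cost f ℓ x₁ u₁ d + cost f ℓ xc uc d
        + Gf d αl γx γu ζ := by
  obtain ⟨u₂, ha, ht, hcat, hest⟩ := hloc xc Hc uc hc hHc hcx N₁ x₁ H₁ u₁ hN hx₁ hH₁ hu₁ hs
    hx₁d x₂ H₂ hx₂ hH₂
  refine ⟨_, hcat, ?_⟩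
  rw [cost_cat f ℓ x₁ x₂ u₁ u₂ d N₁ (by omega) ht]
  have hz0 : 0 ≤ ‖x₂ - xc‖ + measH T (fun j => H₂ j - Hc j) :=
    add_nonneg (norm_nonneg _) (measH_nonneg _ _)
  have hm := max_le hζ₁ hζ₂
  have hm0 := hz0.trans (le_max_left _ (‖traj f x₁ u₁ d - traj f xc uc d‖ +
      measH T (fun j => storedH f h x₁ u₁ d j - storedH f h xc uc d j)))
  have hζ0 : 0 ≤ ζ := hz0.trans hζ₁
  have key : cost f ℓ x₂ u₂ d - cost f ℓ xc uc d ≤ Gf d αl γx γu ζ := by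
    unfold cost Gf
    rw [← Finset.sum_sub_distrib]
    have : ∀ k ∈ Finset.range d, ℓ (traj f x₂ u₂ k) (u₂ k) - ℓ (traj f xc uc k) (uc k)
        ≤ αl (γx ζ + γu ζ) := by
      intro k hk
      have hk' := Finset.mem_range.1 hk
      obtain ⟨e1, e2⟩ := hest k hk'.le
      have e1' := e1.trans (hγx.mono hm0 hm)
      have e2' := e2.trans (hγu.mono hm0 hm)
      have := hlc _ (ha.1 k hk') _ (hc.1 k (by omega))
      refine (le_abs_self _).trans (this.trans (hl.mono (norm_nonneg _) ?_))
      rw [Prod.norm_def]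
      have a1 := hγx.nonneg hζ0
      have a2 := hγu.nonneg hζ0
      exact max_le (by simpa using e1'.trans (by linarith)) (by simpa using e2'.trans (by linarith))
    refine (Finset.sum_le_sum this).trans ?_
    simp
  linarith

/-- Prepend one control value. -/
def consU (a : Vec m) (w : ℕ → Vec m) : ℕ → Vec m
  | 0 => a
  | k + 1 => w k

theorem traj_cons {f : Vec n → Vec m → Vec n} {xs : Vec n} {us : Vec m} (hfix : f xs us = xs)
    (w : ℕ → Vec m) (k : ℕ) : traj f xs (consU us w) (k + 1) = traj f xs w k := by
  induction k with
  | zero => simpa [traj, consU] using hfix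
  | succ k ih =>
    rw [traj, ih]; rfl

theorem admissible_cons {f : Vec n → Vec m → Vec n} {h : Vec n → Vec m → Vec p}
    {Z : Set (Vec n × Vec m)} {T N : ℕ} {xs : Vec n} {us : Vec m}
    (hzs : (xs, us) ∈ Z) (hfix : f xs us = xs) (hhs : ∀ i, h xs us i ≤ 0)
    {w : ℕ → Vec m} (hw : Admissible f h Z T N xs (fun _ => h xs us) w) :
    Admissible f h Z T (N + 1) xs (fun _ => h xs us) (consU us w) := by
  have hsum : ∀ (j : ℕ) (i : Fin p), ∑ k ∈ Finset.range (j + 1),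
      h (traj f xs (consU us w) k) (consU us w k) i
      = h xs us i + ∑ k ∈ Finset.range j, h (traj f xs w k) (w k) i := by
    intro j i
    rw [Finset.sum_range_succ', add_comm]
    simp only [traj_cons hfix]
    rfl
  refine ⟨?_, ?_, ?_⟩
  · intro k hk
    cases k with
    | zero => exact hzs
    | succ k => rw [traj_cons hfix]; exact hw.1 k (by omega)
  · intro j hj i
    obtain ⟨hj1, hj2⟩ := Finset.mem_Icc.1 hj
    obtain ⟨j, rfl⟩ : ∃ j', j = j' + 1 := ⟨j - 1, by omega⟩
    rw [hsum]
    rcases Nat.eq_zero_or_pos j with rfl | hj0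
    · have : ∑ l ∈ Finset.Icc (0 + 1) (T - 1), h xs us i ≤ 0 :=
        Finset.sum_nonpos fun _ _ => hhs i
      have := hhs i
      simp only [Finset.range_zero, Finset.sum_empty]
      linarith
    · have h1 := hw.2.1 j (Finset.mem_Icc.2 ⟨hj0, by omega⟩) i
      have h2 : ∑ l ∈ Finset.Icc j (T - 1), h xs us i
          = h xs us i + ∑ l ∈ Finset.Icc (j + 1) (T - 1), h xs us i := by
        rw [← Finset.add_sum_Ioc_eq_sum_Icc (by omega)]
        have e : Finset.Ioc j (T - 1) = Finset.Icc (j + 1) (T - 1) := by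
          ext a; simp only [Finset.mem_Icc, Finset.mem_Ioc]; omega
        rw [e]
      rw [h2] at h1
      linarith
  · intro s hs i
    cases s with
    | zero =>
      rcases Nat.eq_zero_or_pos T with rfl | hT
      · simp
      obtain ⟨t, rfl⟩ : ∃ t, T = t + 1 := ⟨T - 1, by omega⟩
      have h1 : Finset.Ico 0 (0 + (t + 1)) = Finset.range (t + 1) := by simp
      rw [h1, hsum]
      rcases Nat.eq_zero_or_pos t with rfl | ht
      · simpa using hhs i
      · have h1 := hw.2.1 t (Finset.mem_Icc.2 ⟨ht, by simp⟩) i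
        simpa using h1
    | succ s =>
      have h1 := hw.2.2 s (by omega) i
      have h2 := Finset.sum_Ico_add' (fun k => h (traj f xs (consU us w) k) (consU us w k) i)
        s (s + T) 1
      rw [show s + 1 + T = s + T + 1 by ring, ← h2]
      simp only [traj_cons hfix]
      exact h1

/-- Prepend `Q` copies of `us`. -/
def prepU (us : Vec m) (w : ℕ → Vec m) : ℕ → ℕ → Vec m
  | 0 => w
  | Q + 1 => consU us (prepU us w Q)

theorem prepU_lt (us : Vec m) (w : ℕ → Vec m) (Q k : ℕ) (hk : k < Q) : prepU us w Q k = us := by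
  induction Q generalizing k with
  | zero => omega
  | succ Q ih =>
    cases k with
    | zero => rfl
    | succ k => exact ih k (by omega)

theorem traj_steady {f : Vec n → Vec m → Vec n} {xs : Vec n} {us : Vec m} (hfix : f xs us = xs)
    (k : ℕ) : traj f xs (fun _ => us) k = xs := by
  induction k with
  | zero => rfl
  | succ k ih => rw [traj, ih, hfix]

theorem traj_prep {f : Vec n → Vec m → Vec n} {xs : Vec n} {us : Vec m} (hfix : f xs us = xs)
    (w : ℕ → Vec m) (Q k : ℕ) (hk : k ≤ Q) : traj f xs (prepU us w Q) k = xs := by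
  rw [traj_congr f xs _ (fun _ => us) k (fun i hi => prepU_lt us w Q i (by omega)),
    traj_steady hfix]

theorem admissible_prep {f : Vec n → Vec m → Vec n} {h : Vec n → Vec m → Vec p}
    {Z : Set (Vec n × Vec m)} {T N : ℕ} {xs : Vec n} {us : Vec m}
    (hzs : (xs, us) ∈ Z) (hfix : f xs us = xs) (hhs : ∀ i, h xs us i ≤ 0)
    {w : ℕ → Vec m} (hw : Admissible f h Z T N xs (fun _ => h xs us) w) (Q : ℕ) :
    Admissible f h Z T (N + Q) xs (fun _ => h xs us) (prepU us w Q) := by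
  induction Q with
  | zero => exact hw
  | succ Q ih => exact admissible_cons hzs hfix hhs ih

theorem cost_steady {f : Vec n → Vec m → Vec n} (ℓ : Vec n → Vec m → ℝ) {xs : Vec n}
    {us : Vec m} (hfix : f xs us = xs) (K : ℕ) :
    cost f ℓ xs (fun _ => us) K = K * ℓ xs us := by
  unfold cost
  simp [traj_steady hfix]

theorem prepU_ge (us : Vec m) (w : ℕ → Vec m) (Q k : ℕ) : prepU us w Q (Q + k) = w k := by
  induction Q with
  | zero => simp [prepU]
  | succ Q ih => rw [show Q + 1 + k = Q + k + 1 by ring]; exact ih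

theorem cost_prep {f : Vec n → Vec m → Vec n} (ℓ : Vec n → Vec m → ℝ) {xs : Vec n}
    {us : Vec m} (hfix : f xs us = xs) (w : ℕ → Vec m) (Q N : ℕ) :
    cost f ℓ xs (prepU us w Q) (Q + N) = Q * ℓ xs us + cost f ℓ xs w N := by
  rw [cost_add, traj_prep hfix w Q Q le_rfl,
    cost_congr f ℓ xs _ (fun _ => us) Q (prepU_lt us w Q), cost_steady ℓ hfix]
  simp only [prepU_ge]

theorem admissible_steady {f : Vec n → Vec m → Vec n} {h : Vec n → Vec m → Vec p}
    {Z : Set (Vec n × Vec m)} {T N : ℕ} {xs : Vec n} {us : Vec m}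
    (hzs : (xs, us) ∈ Z) (hfix : f xs us = xs) (hhs : ∀ i, h xs us i ≤ 0) :
    Admissible f h Z T N xs (fun _ => h xs us) (fun _ => us) := by
  refine ⟨fun k _ => by rw [traj_steady hfix]; exact hzs, fun j _ i => ?_, fun s _ i => ?_⟩
  · refine add_nonpos (Finset.sum_nonpos fun _ _ => hhs i) (Finset.sum_nonpos fun k _ => ?_)
    rw [traj_steady hfix]; exact hhs i
  · refine Finset.sum_nonpos fun k _ => ?_
    rw [traj_steady hfix]; exact hhs i

theorem admissible_shift {f : Vec n → Vec m → Vec n} {h : Vec n → Vec m → Vec p}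
    {Z : Set (Vec n × Vec m)} {T N : ℕ} {x : Vec n} {H : ℕ → Vec p} {u : ℕ → Vec m}
    (hu : Admissible f h Z T N x H u) (Q : ℕ) (hQ : T ≤ Q) (hN : Q + T ≤ N) :
    Admissible f h Z T (N - Q) (traj f x u Q)
      (fun k => h (traj f x u (Q - T + k)) (u (Q - T + k))) (fun i => u (Q + i)) := by
  refine ⟨fun k hk => ?_, fun j hj i => ?_, fun s hs i => ?_⟩
  · rw [← traj_add]; exact hu.1 _ (by omega)
  · obtain ⟨hj1, hj2⟩ := Finset.mem_Icc.1 hj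
    simp only [← traj_add]
    have h1 := hu.2.2 (Q - T + j) (by omega) i
    rw [← Finset.sum_Ico_consecutive _ (show Q - T + j ≤ Q by omega)
      (show Q ≤ Q - T + j + T by omega)] at h1
    have e1 : Finset.Icc j (T - 1) = Finset.Ico j T := by
      ext a; simp only [Finset.mem_Icc, Finset.mem_Ico]; omega
    have e2 := Finset.sum_Ico_add (fun k => h (traj f x u k) (u k) i) j T (Q - T)
    have e3 := Finset.sum_Ico_add (fun k => h (traj f x u k) (u k) i) 0 j Q
    rw [e1, Finset.range_eq_Ico, e2, e3]
    have e4 : T + (Q - T) = Q := by omega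
    have e5 : Q - T + j + T = j + Q := by omega
    rw [e5] at h1
    rw [e4, show j + (Q - T) = Q - T + j by omega, zero_add]
    exact h1
  · simp only [← traj_add]
    have e2 := Finset.sum_Ico_add (fun k => h (traj f x u k) (u k) i) s (s + T) Q
    rw [e2]
    have h1 := hu.2.2 (s + Q) (by omega) i
    rw [show s + T + Q = s + Q + T by omega]
    exact h1

theorem sum_h_nonpos {f : Vec n → Vec m → Vec n} {h : Vec n → Vec m → Vec p}
    {Z : Set (Vec n × Vec m)} {T N : ℕ} {x : Vec n} {H : ℕ → Vec p} {u : ℕ → Vec m}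
    (hu : Admissible f h Z T N x H u) (j : ℕ) (hj : j * T ≤ N) (i : Fin p) :
    ∑ k ∈ Finset.range (j * T), h (traj f x u k) (u k) i ≤ 0 := by
  induction j with
  | zero => simp
  | succ j ih =>
    have e : (j + 1) * T = j * T + T := by ring
    rw [e] at hj ⊢
    have h1 := hu.2.2 (j * T) hj i
    rw [← Finset.sum_range_add_sum_Ico _ (show j * T ≤ j * T + T by omega)]
    have := ih (by omega)
    linarith

theorem diss_sum {f : Vec n → Vec m → Vec n} {ℓ : Vec n → Vec m → ℝ}
    {h : Vec n → Vec m → Vec p} {Z : Set (Vec n × Vec m)} {lam : Vec n → ℝ} {lb : Vec p}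
    {ρ : ℝ → ℝ} {xs : Vec n} {us : Vec m}
    (hdiss : ∀ z ∈ Z, lam (f z.1 z.2) - lam z.1 ≤
      ℓ z.1 z.2 - ℓ xs us + (∑ i, lb i * h z.1 z.2 i) - ρ ‖(z.1 - xs, z.2 - us)‖)
    {x : Vec n} {u : ℕ → Vec m} (K : ℕ) (hK : ∀ k < K, (traj f x u k, u k) ∈ Z) :
    K * ℓ xs us + ∑ k ∈ Finset.range K, ρ ‖(traj f x u k - xs, u k - us)‖
      + lam (traj f x u K) - lam x ≤ cost f ℓ x u K
        + ∑ i, lb i * ∑ k ∈ Finset.range K, h (traj f x u k) (u k) i := by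
  induction K with
  | zero => simp [cost, traj]
  | succ K ih =>
    have h1 := ih fun k hk => hK k (by omega)
    have h2 := hdiss _ (hK K (by omega))
    simp only [cost] at h1 ⊢
    simp only [Finset.sum_range_succ, mul_add, Finset.sum_add_distrib]
    push_cast
    rw [traj]
    simp only at h2
    linarith

/-- Dissipation inequality over a multiple of the period. -/
theorem diss_block {f : Vec n → Vec m → Vec n} {ℓ : Vec n → Vec m → ℝ}
    {h : Vec n → Vec m → Vec p} {Z : Set (Vec n × Vec m)} {lam : Vec n → ℝ} {lb : Vec p}
    {ρ : ℝ → ℝ} {xs : Vec n} {us : Vec m}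
    (hdiss : ∀ z ∈ Z, lam (f z.1 z.2) - lam z.1 ≤
      ℓ z.1 z.2 - ℓ xs us + (∑ i, lb i * h z.1 z.2 i) - ρ ‖(z.1 - xs, z.2 - us)‖)
    (hlb : ∀ i, 0 ≤ lb i) {T N : ℕ} {x : Vec n} {H : ℕ → Vec p} {u : ℕ → Vec m}
    (hu : Admissible f h Z T N x H u) (j : ℕ) (hj : j * T ≤ N) :
    ((j * T : ℕ) : ℝ) * ℓ xs us + ∑ k ∈ Finset.range (j * T), ρ ‖(traj f x u k - xs, u k - us)‖
      + lam (traj f x u (j * T)) - lam x ≤ cost f ℓ x u (j * T) := by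
  have h1 := diss_sum hdiss (x := x) (u := u) (j * T) (fun k hk => hu.1 k (by omega))
  have h2 : ∑ i, lb i * ∑ k ∈ Finset.range (j * T), h (traj f x u k) (u k) i ≤ 0 :=
    Finset.sum_nonpos fun i _ =>
      mul_nonpos_of_nonneg_of_nonpos (hlb i) (sum_h_nonpos hu j hj i)
  linarith

theorem block_sum (a : ℕ → ℝ) (ha : ∀ k, 0 ≤ a k) (T j₀ M : ℕ) (c : ℝ)
    (hbad : ∀ j, j₀ ≤ j → j < j₀ + M → ∃ k, j * T ≤ k ∧ k < j * T + T ∧ c ≤ a k) :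
    M * c ≤ ∑ k ∈ Finset.range ((j₀ + M) * T), a k := by
  induction M with
  | zero => simpa using Finset.sum_nonneg fun k _ => ha k
  | succ M ih =>
    have h1 := ih fun j h1 h2 => hbad j h1 (by omega)
    obtain ⟨k, hk1, hk2, hk3⟩ := hbad (j₀ + M) (by omega) (by omega)
    rw [show (j₀ + (M + 1)) * T = (j₀ + M) * T + T by ring,
      ← Finset.sum_range_add_sum_Ico _ (show (j₀ + M) * T ≤ (j₀ + M) * T + T by omega)]
    have h2 := Finset.single_le_sum (f := a) (s := Finset.Ico ((j₀ + M) * T) ((j₀ + M) * T + T))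
      (fun i _ => ha i) (Finset.mem_Ico.2 ⟨hk1, hk2⟩)
    push_cast
    linarith

theorem value_function_local_continuity (n m p T : ℕ) (hT : 1 ≤ T)
    (f : Vec n → Vec m → Vec n) (ℓ : Vec n → Vec m → ℝ)
    (h : Vec n → Vec m → Vec p) (Z : Set (Vec n × Vec m)) (Lh : ℝ)
    (xs : Vec n) (us : Vec m) (lam : Vec n → ℝ) (lb : Vec p) (ρ : ℝ → ℝ)
    (δc Eh : ℝ) (d : ℕ) (γx γu : ℝ → ℝ)
    (ustar : ℕ → Vec n → (ℕ → Vec p) → ℕ → Vec m)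
    -- Assumption 1 (compactness and continuity)
    (hZ : IsCompact Z)
    (hfc : ∃ αf : ℝ → ℝ, KInf αf ∧ ∀ z₁ ∈ Z, ∀ z₂ ∈ Z,
      ‖f z₁.1 z₁.2 - f z₂.1 z₂.2‖ ≤ αf ‖(z₁.1 - z₂.1, z₁.2 - z₂.2)‖)
    (halc : ∃ αl : ℝ → ℝ, KInf αl ∧ ∀ z₁ ∈ Z, ∀ z₂ ∈ Z,
      |ℓ z₁.1 z₁.2 - ℓ z₂.1 z₂.2| ≤ αl ‖(z₁.1 - z₂.1, z₁.2 - z₂.2)‖)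
    (hLh : 0 < Lh)
    (hhL : ∀ z₁ ∈ Z, ∀ z₂ ∈ Z,
      ‖h z₁.1 z₁.2 - h z₂.1 z₂.2‖ ≤ Lh * ‖(z₁.1 - z₂.1, z₁.2 - z₂.2)‖)
    -- optimal steady-state
    (hzs : (xs, us) ∈ Z) (hfix : f xs us = xs) (hhs : ∀ i, h xs us i ≤ 0)
    -- Assumption 2 (strict dissipativity)
    (hρ : KInf ρ) (hlb : ∀ i, 0 ≤ lb i) (hlam0 : lam xs = 0)
    (hlamc : ∃ αlam : ℝ → ℝ, KInf αlam ∧ ∀ x₁ ∈ Prod.fst '' Z, ∀ x₂ ∈ Prod.fst '' Z,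
      |lam x₁ - lam x₂| ≤ αlam ‖x₁ - x₂‖)
    (hdiss : ∀ z ∈ Z, lam (f z.1 z.2) - lam z.1 ≤
      ℓ z.1 z.2 - ℓ xs us + (∑ i, lb i * h z.1 z.2 i) - ρ ‖(z.1 - xs, z.2 - us)‖)
    -- Assumption 3 (asymptotic controllability)
    (hac : ∃ β₁ β₂ : ℝ → ℕ → ℝ, KLS β₁ ∧ KLS β₂ ∧
      ∀ x ∈ Prod.fst '' Z, ∀ H ∈ HSet h Z T, ∀ N : ℕ, ∃ u : ℕ → Vec m,
        Admissible f h Z T N x H u ∧ ∀ k < N,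
          ℓ (traj f x u k) (u k) - ℓ xs us ≤
            β₁ ‖x - xs‖ k + β₂ (measH T (fun j => H j - h xs us)) k ∧
          rot f ℓ h (ℓ xs us) lam lb (traj f x u k) (u k) ≤
            β₁ ‖x - xs‖ k + β₂ (measH T (fun j => H j - h xs us)) k)
    -- Assumption 4 (local controllability)
    (hδc : 0 < δc) (hEh : 0 < Eh) (hdT : T ≤ d) (hγx : KInf γx) (hγu : KInf γu)
    (hloc : LocCtrl f h Z T xs δc Eh d γx γu)
    -- the value function is attained by the unique minimizer `ustar`
    (hopt : ∀ (N : ℕ), ∀ x ∈ Prod.fst '' Z, ∀ H ∈ HSet h Z T,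
      Admissible f h Z T N x H (ustar N x H) ∧
      cost f ℓ x (ustar N x H) N = Jstar f ℓ h Z T N x H ∧
      ∀ u : ℕ → Vec m, Admissible f h Z T N x H u →
        cost f ℓ x u N = Jstar f ℓ h Z T N x H → ∀ k < N, u k = ustar N x H k)
    :
    ∃ (N₂ : ℕ) (γv : ℝ → ℝ), KInf γv ∧
      ∀ δ E : ℝ, 0 < δ → δ ≤ δc → 0 < E → E ≤ Eh →
        ∀ N : ℕ, N₂ ≤ N → ∀ x : Vec n, ‖x - xs‖ ≤ δ →
          ∀ H ∈ HSet h Z T, norm1H T (fun j => H j - h xs us) ≤ E →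
            |Jstar f ℓ h Z T N x H - Jstar f ℓ h Z T N xs (fun _ => h xs us)| ≤
              γv (δ + E) := by
  obtain ⟨αl, hl, hlc⟩ := halc
  obtain ⟨αm, hm, hmc⟩ := hlamc
  obtain ⟨β₁, β₂, hβ₁, hβ₂, hac⟩ := hac
  have hd1 : 1 ≤ d := by omega
  have hxsX : xs ∈ Prod.fst '' Z := ⟨(xs, us), hzs, rfl⟩
  -- bounds on the compact set
  obtain ⟨D, hD⟩ : ∃ D : ℝ, ∀ z ∈ Z, ‖(z.1 - xs, z.2 - us)‖ ≤ D := by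
    obtain ⟨D, hD⟩ := (Metric.isBounded_iff_subset_closedBall (xs, us)).1 hZ.isBounded
    refine ⟨D, fun z hz => ?_⟩
    have := hD hz
    rw [Metric.mem_closedBall, dist_eq_norm] at this
    exact this
  have hD0 : 0 ≤ D := (norm_nonneg _).trans (hD _ hzs)
  obtain ⟨M, hM0, hM⟩ : ∃ M : ℝ, 0 ≤ M ∧ ∀ z ∈ Z, |ℓ z.1 z.2 - ℓ xs us| ≤ M :=
    ⟨αl D, hl.nonneg hD0, fun z hz =>
      (hlc z hz _ hzs).trans (hl.mono (norm_nonneg _) (hD z hz))⟩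
  obtain ⟨Λ, hΛ⟩ : ∃ Λ : ℝ, ∀ x ∈ Prod.fst '' Z, |lam x| ≤ Λ := by
    refine ⟨αm D, ?_⟩
    rintro _ ⟨z, hz, rfl⟩
    have h1 := hmc z.1 ⟨z, hz, rfl⟩ xs hxsX
    rw [hlam0, sub_zero] at h1
    refine h1.trans (hm.mono (norm_nonneg _) (le_trans ?_ (hD z hz)))
    exact norm_fst_le (z.1 - xs, z.2 - us)
  have hhb : ∀ z ∈ Z, ∀ i : Fin p, |h z.1 z.2 i - h xs us i| ≤ Lh * ‖(z.1 - xs, z.2 - us)‖ := by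
    intro z hz i
    have h1 := hhL z hz _ hzs
    have h2 := PiLp.norm_apply_le (h z.1 z.2 - h xs us) i
    rw [PiLp.sub_apply, Real.norm_eq_abs] at h2
    exact h2.trans h1
  have hHZ : ∀ g : ℕ → Vec n × Vec m, (∀ k ∈ Finset.Icc 1 (T - 1), g k ∈ Z) →
      (fun k => h (g k).1 (g k).2) ∈ HSet h Z T := by
    intro g hg k hk i
    have hb : ∀ z ∈ Z, |h z.1 z.2 i - h xs us i| ≤ Lh * D := fun z hz =>
      (hhb z hz i).trans (mul_le_mul_of_nonneg_left (hD z hz) hLh.le)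
    constructor
    · refine csInf_le ⟨h xs us i - Lh * D, ?_⟩ ⟨g k, hg k hk, rfl⟩
      rintro _ ⟨z, hz, rfl⟩
      have := (abs_le.1 (hb z hz)).1
      simp only; linarith
    · refine le_csSup ⟨h xs us i + Lh * D, ?_⟩ ⟨g k, hg k hk, rfl⟩
      rintro _ ⟨z, hz, rfl⟩
      have := (abs_le.1 (hb z hz)).2
      simp only; linarith
  have hHs : (fun _ => h xs us) ∈ HSet h Z T := hHZ (fun _ => (xs, us)) (fun _ _ => hzs)
  have hmHs : measH T (fun _ => h xs us) = 0 := measH_zero' _ _ (fun _ _ i => hhs i)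
  have hm0 : measH T (fun _ => h xs us - h xs us) = 0 :=
    measH_zero' _ _ (fun _ _ i => by simp)
  -- value function is a lower bound
  have hJle : ∀ (N : ℕ) (x : Vec n) (H : ℕ → Vec p) (u : ℕ → Vec m),
      Admissible f h Z T N x H u → Jstar f ℓ h Z T N x H ≤ cost f ℓ x u N := by
    intro N x H u hu
    refine csInf_le ⟨∑ k ∈ Finset.range N, (ℓ xs us - M), ?_⟩ ⟨u, hu, rfl⟩
    rintro _ ⟨v, hv, rfl⟩
    refine Finset.sum_le_sum fun k hk => ?_
    have := (abs_le.1 (hM _ (hv.1 k (Finset.mem_range.1 hk)))).1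
    simp only at this
    linarith
  -- local controllability relative to the steady state
  have hcs : Admissible f h Z T (d + T) xs (fun _ => h xs us) (fun _ => us) :=
    admissible_steady hzs hfix hhs
  have hcsx : ∀ k ≤ d + T, ‖traj f xs (fun _ => us) k - xs‖ ≤ δc := by
    intro k _
    rw [traj_steady hfix, sub_self, norm_zero]; exact hδc.le
  have hsts : ∀ k, storedH f h xs (fun _ => us) d k = h xs us := by
    intro k; simp only [storedH, traj_steady hfix]
  have hsteer : ∀ (N₁ : ℕ) (x₁ : Vec n) (H₁ : ℕ → Vec p) (u₁ : ℕ → Vec m),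
      d + T ≤ N₁ → x₁ ∈ Prod.fst '' Z → H₁ ∈ HSet h Z T → Admissible f h Z T N₁ x₁ H₁ u₁ →
      ∀ (ζ₁ : ℝ), measH T (fun k => storedH f h x₁ u₁ d k - h xs us) ≤ Eh →
      ‖traj f x₁ u₁ d - xs‖ ≤ δc →
      ‖traj f x₁ u₁ d - xs‖ + measH T (fun k => storedH f h x₁ u₁ d k - h xs us) ≤ ζ₁ →
      ∀ (x₂ : Vec n) (H₂ : ℕ → Vec p), ‖x₂ - xs‖ ≤ δc →
        measH T (fun k => H₂ k - h xs us) ≤ Eh →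
        ‖x₂ - xs‖ + measH T (fun k => H₂ k - h xs us) ≤ ζ₁ →
      ∃ v : ℕ → Vec m, Admissible f h Z T N₁ x₂ H₂ v ∧
        cost f ℓ x₂ v N₁ ≤ cost f ℓ x₁ u₁ N₁ - cost f ℓ x₁ u₁ d + d * ℓ xs us
          + Gf d αl γx γu ζ₁ := by
    intro N₁ x₁ H₁ u₁ a1 a2 a3 a4 ζ₁ a5 a6 a7 x₂ H₂ a8 a9 a10
    have := loc_core hl hlc hγx hγu hloc hcs (by rw [hmHs]; exact hEh.le) hcsx a1 a2 a3 a4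
      (by simpa only [hsts] using a5) a6 a8 a9 a10
      (by simpa only [hsts, traj_steady hfix] using a7)
    rwa [cost_steady ℓ hfix] at this
  have hX : ∀ (x : Vec n) (H : ℕ → Vec p), ‖x - xs‖ ≤ δc →
      measH T (fun k => H k - h xs us) ≤ Eh → x ∈ Prod.fst '' Z := by
    intro x H hx hH
    obtain ⟨v, hv, -⟩ := hsteer (d + T) xs (fun _ => h xs us) (fun _ => us) le_rfl hxsX hHs hcs
      (‖x - xs‖ + measH T (fun k => H k - h xs us))
      (by simp only [hsts]; rw [hm0]; exact hEh.le)
      (by rw [traj_steady hfix, sub_self, norm_zero]; exact hδc.le)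
      (by simp only [hsts]; rw [hm0, traj_steady hfix, sub_self, norm_zero, zero_add]
          exact add_nonneg (norm_nonneg _) (measH_nonneg _ _))
      x H hx hH le_rfl
    exact ⟨_, hv.1 0 (by omega), rfl⟩
  -- global upper bound
  obtain ⟨B, hB⟩ : ∃ B : ℝ, ∀ (N : ℕ) (x : Vec n), ∀ H ∈ HSet h Z T, ‖x - xs‖ ≤ δc →
      measH T (fun k => H k - h xs us) ≤ Eh →
      Jstar f ℓ h Z T N x H ≤ N * ℓ xs us + B := by
    refine ⟨(∑' k, β₁ δc k) + ∑' k, β₂ Eh k, fun N x H hH hx hHE => ?_⟩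
    obtain ⟨u, hu, hub⟩ := hac x (hX x H hx hHE) H hH N
    refine (hJle N x H u hu).trans ?_
    have h1 : cost f ℓ x u N ≤ ∑ k ∈ Finset.range N, (ℓ xs us + (β₁ δc k + β₂ Eh k)) := by
      refine Finset.sum_le_sum fun k hk => ?_
      have h2 := (hub k (Finset.mem_range.1 hk)).1
      have h3 : β₁ ‖x - xs‖ k ≤ β₁ δc k := (hβ₁.1 k).2.1.monotoneOn
        (Set.mem_Ici.2 (norm_nonneg _)) (Set.mem_Ici.2 hδc.le) hx
      have h4 : β₂ (measH T (fun j => H j - h xs us)) k ≤ β₂ Eh k := (hβ₂.1 k).2.1.monotoneOn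
        (Set.mem_Ici.2 (measH_nonneg _ _)) (Set.mem_Ici.2 hEh.le) hHE
      linarith
    have h5 : ∑ k ∈ Finset.range N, β₁ δc k ≤ ∑' k, β₁ δc k :=
      (hβ₁.2.2.1 δc hδc.le).sum_le_tsum _ (fun k _ => (hβ₁.2.1 δc hδc.le).2.1 k)
    have h6 : ∑ k ∈ Finset.range N, β₂ Eh k ≤ ∑' k, β₂ Eh k :=
      (hβ₂.2.2.1 Eh hEh.le).sum_le_tsum _ (fun k _ => (hβ₂.2.1 Eh hEh.le).2.1 k)
    simp only [Finset.sum_add_distrib, Finset.sum_const, Finset.card_range, nsmul_eq_mul] at h1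
    linarith
  have hρ0 : ∀ (x : Vec n) (u : ℕ → Vec m) (k : ℕ),
      0 ≤ ρ ‖(traj f x u k - xs, u k - us)‖ := fun x u k => hρ.nonneg (norm_nonneg _)
  -- global lower bound
  have hlow : ∀ (N : ℕ) (x : Vec n) (H : ℕ → Vec p) (u : ℕ → Vec m), 1 ≤ N →
      Admissible f h Z T N x H u →
      N * ℓ xs us + ∑ k ∈ Finset.range ((N - 1) / T * T), ρ ‖(traj f x u k - xs, u k - us)‖
        - (2 * Λ + T * M) ≤ cost f ℓ x u N := by
    intro N x H u hN hu
    have hP : (N - 1) / T * T ≤ N - 1 := Nat.div_mul_le_self _ _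
    have hP2 : N - (N - 1) / T * T ≤ T := by
      have := Nat.lt_div_mul_add (a := N - 1) (b := T) (by omega)
      omega
    have h1 := diss_block hdiss hlb hu ((N - 1) / T) (by omega)
    set P := (N - 1) / T * T with hPdef
    obtain ⟨b, hb⟩ := Nat.exists_eq_add_of_le (show P ≤ N by omega)
    have hbT : b ≤ T := by omega
    have h2 := (abs_le.1 (hΛ _ ⟨_, hu.1 P (by omega), rfl⟩)).1
    have h3 := (abs_le.1 (hΛ _ ⟨_, hu.1 0 (by omega), rfl⟩)).2
    simp only [traj] at h2 h3
    have h4 : (b : ℝ) * (ℓ xs us - M) ≤ cost f ℓ (traj f x u P) (fun i => u (P + i)) b := by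
      have : ∑ k ∈ Finset.range b, (ℓ xs us - M)
          ≤ cost f ℓ (traj f x u P) (fun i => u (P + i)) b := by
        refine Finset.sum_le_sum fun k hk => ?_
        rw [← traj_add]
        have hk' := Finset.mem_range.1 hk
        have := (abs_le.1 (hM _ (hu.1 (P + k) (by omega)))).1
        simp only at this
        linarith
      rwa [Finset.sum_const, Finset.card_range, nsmul_eq_mul] at this
    have h5 : (b : ℝ) * M ≤ T * M := mul_le_mul_of_nonneg_right (by exact_mod_cast hbT) hM0
    have h6 : cost f ℓ x u N = cost f ℓ x u P
        + cost f ℓ (traj f x u P) (fun i => u (P + i)) b := by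
      rw [hb]; exact cost_add _ _ _ _ _ _
    have h7 : (N : ℝ) = P + b := by rw [hb]; push_cast; ring
    rw [h6, h7]
    linarith
  have hG := Gf_cont (d := d) hl hγx hγu
  have hG0 := Gf_zero (d := d) hl hγx hγu
  -- the optimal trajectory stays local initially
  obtain ⟨r₀, hr₀, hr₀δ, hr₀E, N₂, hN₂, hstay⟩ : ∃ r₀ > 0, r₀ ≤ δc ∧ r₀ ≤ Eh ∧ ∃ N₂ : ℕ,
      d + T + 1 ≤ N₂ ∧ ∀ N ≥ N₂, ∀ (x : Vec n), ∀ H ∈ HSet h Z T,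
        ‖x - xs‖ + measH T (fun k => H k - h xs us) ≤ r₀ →
        ∀ k ≤ d + T, ‖traj f x (ustar N x H) k - xs‖ ≤ δc := by
    have hε : 0 < ρ δc / 4 := by have := hρ.pos hδc; positivity
    obtain ⟨rG, hrG, hrG'⟩ := small_of_cont hG hG0 hε
    obtain ⟨rm, hrm, hrm'⟩ := small_of_cont hm.1 hm.2.2.1 hε
    -- radius for the initial condition
    obtain ⟨r, hr, hr1, hr2, hr3, hr4⟩ : ∃ r > 0, r ≤ rG ∧ r ≤ rm ∧ r ≤ δc ∧ r ≤ Eh :=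
      ⟨min (min rG rm) (min δc Eh), by positivity,
        (min_le_left _ _).trans (min_le_left _ _), (min_le_left _ _).trans (min_le_right _ _),
        (min_le_right _ _).trans (min_le_left _ _), (min_le_right _ _).trans (min_le_right _ _)⟩
    -- turnpike radius
    have hp0 : (0 : ℝ) < 1 + p * Lh := by positivity
    obtain ⟨η, hη, hη2⟩ : ∃ η > 0, (1 + p * Lh) * η ≤ r :=
      ⟨r / (1 + p * Lh), by positivity, by rw [mul_div_cancel₀ _ hp0.ne']⟩
    have hpη : 0 ≤ p * Lh * η := by positivity
    have hηr : η ≤ r := by linarith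
    obtain ⟨W, hW⟩ := exists_nat_gt ((B + (2 * Λ + T * M)) / ρ η)
    rw [div_lt_iff₀ (hρ.pos hη)] at hW
    refine ⟨r, hr, hr3, hr4, (2 * d + T + W) * T + 1 + (d + T + 1), by omega, ?_⟩
    intro N hN x H hH hxH k hk
    have hmn := measH_nonneg T (fun k => H k - h xs us)
    have hxn := norm_nonneg (x - xs)
    have hxδ : ‖x - xs‖ ≤ δc := by linarith
    have hHE : measH T (fun k => H k - h xs us) ≤ Eh := by linarith
    have hxX := hX x H hxδ hHE
    obtain ⟨hu, hcu, -⟩ := hopt N x hxX H hH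
    set u := ustar N x H with hudef
    have hJ := hB N x H hH hxδ hHE
    have hL := hlow N x H u (by omega) hu
    -- find a good block
    obtain ⟨j, hj1, hj2, hjgood⟩ : ∃ j, 2 * d + T ≤ j ∧ j < 2 * d + T + W ∧
        ∀ k, j * T ≤ k → k < j * T + T → ‖(traj f x u k - xs, u k - us)‖ ≤ η := by
      by_contra hcon
      push Not at hcon
      have h1 := block_sum (fun k => ρ ‖(traj f x u k - xs, u k - us)‖) (hρ0 x u) T
        (2 * d + T) W (ρ η) (fun j h1 h2 => by
          obtain ⟨k, hk1, hk2, hk3⟩ := hcon j h1 h2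
          exact ⟨k, hk1, hk2, hρ.mono hη.le hk3.le⟩)
      have h2 : (2 * d + T + W) * T ≤ (N - 1) / T * T := by
        refine Nat.mul_le_mul_right _ ((Nat.le_div_iff_mul_le (by omega)).2 (by omega))
      have h3 := Finset.sum_le_sum_of_subset_of_nonneg (Finset.range_subset_range.2 h2)
        (fun i _ _ => hρ0 x u i)
      linarith
    have hjP : 2 * d + T ≤ j * T := hj1.trans (Nat.le_mul_of_pos_right _ (by omega))
    have hjN : j * T + T ≤ N := by
      have : (j + 1) * T ≤ (2 * d + T + W) * T := Nat.mul_le_mul_right _ (by omega)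
      rw [add_mul, one_mul] at this
      omega
    have hdb := diss_block hdiss hlb hu j (by omega)
    set P := j * T with hPdef
    obtain ⟨Q, hQ⟩ : ∃ Q, P = Q + d := ⟨P - d, by omega⟩
    have hgP := hjgood P le_rfl (by omega)
    have hxP : ‖traj f x u P - xs‖ ≤ η :=
      (norm_fst_le (traj f x u P - xs, u P - us)).trans hgP
    have hPX : traj f x u P ∈ Prod.fst '' Z := ⟨_, hu.1 P (by omega), rfl⟩
    -- first steering: steady state to the turnpike window
    have htd : traj f (traj f x u Q) (fun i => u (Q + i)) d = traj f x u P := by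
      rw [← traj_add, hQ]
    have hmst : measH T (fun k => storedH f h (traj f x u Q) (fun i => u (Q + i)) d k - h xs us)
        ≤ p * Lh * η := by
      refine measH_le hpη fun k hk => ?_
      obtain ⟨hk1, hk2⟩ := Finset.mem_Icc.1 hk
      have : ∀ i ∈ (Finset.univ : Finset (Fin p)),
          max ((storedH f h (traj f x u Q) (fun i => u (Q + i)) d k - h xs us) i) 0
            ≤ Lh * η := by
        intro i _
        refine max_le ?_ (by positivity)
        simp only [storedH, ← traj_add, PiLp.sub_apply]
        have h1 := hhb _ (hu.1 (Q + (d + k - 1)) (by omega)) i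
        refine (le_abs_self _).trans (h1.trans (mul_le_mul_of_nonneg_left ?_ hLh.le))
        exact hjgood _ (by omega) (by omega)
      refine (Finset.sum_le_sum this).trans ?_
      simp [mul_assoc]
    obtain ⟨w, hw, hwc⟩ := hsteer (N - Q) (traj f x u Q) _ (fun i => u (Q + i)) (by omega)
      ⟨_, hu.1 Q (by omega), rfl⟩
      (hHZ (fun k => (traj f x u (Q - T + k), u (Q - T + k))) (fun k hk => hu.1 _ (by
        have := Finset.mem_Icc.1 hk; omega)))
      (admissible_shift hu Q (by omega) (by omega)) r
      (by linarith) (by rw [htd]; linarith) (by rw [htd]; linarith)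
      xs (fun _ => h xs us) (by rw [sub_self, norm_zero]; exact hδc.le)
      (by rw [hm0]; exact hEh.le) (by rw [hm0, sub_self, norm_zero]; linarith)
    -- prepend the steady state
    have hv := admissible_prep hzs hfix hhs hw Q
    have hvc := cost_prep (f := f) ℓ hfix w Q (N - Q)
    rw [show N - Q + Q = N by omega] at hv
    rw [show Q + (N - Q) = N by omega] at hvc
    have hvd : cost f ℓ xs (prepU us w Q) d = d * ℓ xs us := by
      rw [cost_congr f ℓ xs _ (fun _ => us) d (fun k hk => prepU_lt us w Q k (by omega)),
        cost_steady ℓ hfix]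
    have hvs : measH T (fun k => storedH f h xs (prepU us w Q) d k - h xs us) = 0 := by
      refine measH_zero' _ _ fun k hk i => ?_
      obtain ⟨hk1, hk2⟩ := Finset.mem_Icc.1 hk
      simp only [storedH]
      rw [traj_prep hfix w Q _ (by omega), prepU_lt us w Q _ (by omega)]
      simp
    have hvt : traj f xs (prepU us w Q) d = xs := traj_prep hfix w Q d (by omega)
    -- second steering
    obtain ⟨y, hy, hyc⟩ := hsteer N xs _ (prepU us w Q) (by omega) hxsX hHs hv r
      (by rw [hvs]; exact hEh.le) (by rw [hvt, sub_self, norm_zero]; exact hδc.le)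
      (by rw [hvs, hvt, sub_self, norm_zero]; linarith) x H hxδ hHE hxH
    have hopt1 := hJle N x H y hy
    rw [hvd, hvc] at hyc
    have hcN : cost f ℓ x u N = cost f ℓ x u Q
        + cost f ℓ (traj f x u Q) (fun i => u (Q + i)) (N - Q) := by
      rw [← cost_add, show Q + (N - Q) = N by omega]
    have hcP : cost f ℓ x u P = cost f ℓ x u Q
        + cost f ℓ (traj f x u Q) (fun i => u (Q + i)) d := by
      rw [← cost_add, hQ]
    have hPr : (P : ℝ) = Q + d := by rw [hQ]; push_cast; ring
    have hGr := hrG' r hr.le hr1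
    have hl1 := hmc _ hPX xs hxsX
    have hl2 := hmc _ hxX xs hxsX
    rw [hlam0, sub_zero] at hl1 hl2
    have hl1' := (abs_le.1 hl1).1
    have hl2' := (abs_le.1 hl2).2
    have hs1 := hrm' _ (norm_nonneg (traj f x u P - xs)) (by linarith)
    have hs2 := hrm' _ (norm_nonneg (x - xs)) (by linarith)
    have hsum : ∑ k ∈ Finset.range P, ρ ‖(traj f x u k - xs, u k - us)‖ < ρ δc := by
      rw [hPr] at hdb
      linarith
    have hone := Finset.single_le_sum (f := fun k => ρ ‖(traj f x u k - xs, u k - us)‖)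
      (fun i _ => hρ0 x u i) (Finset.mem_range.2 (show k < P by omega))
    have hlt := hone.trans_lt hsum
    by_contra hcon
    push Not at hcon
    have h1 : δc ≤ ‖(traj f x u k - xs, u k - us)‖ :=
      hcon.le.trans (norm_fst_le (traj f x u k - xs, u k - us))
    have h2 := hρ.mono hδc.le h1
    linarith
  -- comparison of two initial conditions
  have hcomp : ∀ N ≥ N₂, ∀ (x : Vec n), ∀ H ∈ HSet h Z T,
      ‖x - xs‖ + measH T (fun k => H k - h xs us) ≤ r₀ → measH T H ≤ Eh →
      ∀ (x₂ : Vec n) (H₂ : ℕ → Vec p), ‖x₂ - xs‖ ≤ δc → measH T (fun k => H₂ k - H k) ≤ Eh →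
      ∀ ζ : ℝ, ‖x₂ - x‖ + measH T (fun k => H₂ k - H k) ≤ ζ →
      Jstar f ℓ h Z T N x₂ H₂ ≤ Jstar f ℓ h Z T N x H + Gf d αl γx γu ζ := by
    intro N hN x H hH hxH hHE x₂ H₂ hx₂ hH₂ ζ hζ
    have hmn := measH_nonneg T (fun k => H k - h xs us)
    have hxn := norm_nonneg (x - xs)
    have hxX := hX x H (by linarith) (by linarith)
    obtain ⟨hu, hcu, -⟩ := hopt N x hxX H hH
    have hst := hstay N hN x H hH hxH
    have hz : measH T (fun k => storedH f h x (ustar N x H) d k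
        - storedH f h x (ustar N x H) d k) = 0 := measH_zero' _ _ (fun _ _ i => by simp)
    have hζ0 : 0 ≤ ζ := (add_nonneg (norm_nonneg _) (measH_nonneg _ _)).trans hζ
    obtain ⟨v, hv, hvc⟩ := loc_core hl hlc hγx hγu hloc (hu.mono (by omega)) hHE hst
      (show d + T ≤ N by omega) hxX hH hu (by rw [hz]; exact hEh.le) (hst d (by omega)) hx₂ hH₂ hζ
      (by rw [hz, sub_self, norm_zero, zero_add]; exact hζ0)
    have := hJle N x₂ H₂ v hv
    linarith
  -- conclusion
  set C : ℝ := |B| + |2 * Λ + T * M| with hC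
  have hC0 : 0 ≤ C := by positivity
  refine ⟨N₂, fun r => Gf d αl γx γu r + (C / r₀ + 1) * r, ⟨?_, ?_, ?_, ?_⟩, ?_⟩
  · exact hG.add (continuousOn_const.mul continuousOn_id)
  · intro a ha b hb hab
    have h1 := Gf_mono (d := d) hl hγx hγu ha hab.le
    have h2 : (C / r₀ + 1) * a < (C / r₀ + 1) * b := mul_lt_mul_of_pos_left hab (by positivity)
    simp only; linarith
  · simp [hG0]
  · refine tendsto_atTop_mono' atTop ?_ (tendsto_id)
    filter_upwards [eventually_ge_atTop 0] with r hr
    have h1 := Gf_nonneg (d := d) hl hγx hγu hr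
    have h2 : 0 ≤ C / r₀ * r := by positivity
    simp only [id]; linarith
  · intro δ E hδ hδ' hE hE' N hN x hx H hH hHE
    have hcol : ∀ k ∈ Finset.Icc 1 (T - 1), l1 (H k - h xs us) ≤ E := fun k hk =>
      (le_norm1H T (fun j => H j - h xs us) k hk).trans hHE
    have hmE : measH T (fun k => H k - h xs us) ≤ E :=
      measH_le hE.le fun k hk => (hatCol_le_l1 _ k).trans (hcol k hk)
    have hmE' : measH T (fun k => h xs us - H k) ≤ E := by
      refine measH_le hE.le fun k hk => (hatCol_le_l1 _ k).trans (le_trans (le_of_eq ?_) (hcol k hk))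
      simp only [l1, PiLp.sub_apply]
      exact Finset.sum_congr rfl fun i _ => abs_sub_comm _ _
    have hGn := Gf_nonneg (d := d) hl hγx hγu (add_nonneg hδ.le hE.le)
    rcases le_or_gt (δ + E) r₀ with hsmall | hbig
    · have hmH : measH T H ≤ Eh := by
        refine measH_le hEh.le fun k hk => ?_
        refine le_trans ?_ ((hatCol_le_l1 (fun j => H j - h xs us) k).trans
          ((hcol k hk).trans hE'))
        refine Finset.sum_le_sum fun i _ => max_le_max ?_ le_rfl
        have := hhs i
        simp only [PiLp.sub_apply]; linarith
      have h1 := hcomp N hN x H hH (by linarith) hmH xs (fun _ => h xs us)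
        (by rw [sub_self, norm_zero]; exact hδc.le) (hmE'.trans hE') (δ + E)
        (by rw [norm_sub_rev]; linarith)
      have h2 := hcomp N hN xs _ hHs (by rw [hm0, sub_self, norm_zero]; linarith)
        (by rw [hmHs]; exact hEh.le) x H (hx.trans hδ') (hmE.trans hE') (δ + E) (by linarith)
      have h3 : 0 ≤ (C / r₀ + 1) * (δ + E) := by positivity
      rw [abs_le]
      constructor <;> linarith
    · have hb : ∀ (x : Vec n), ∀ H ∈ HSet h Z T, ‖x - xs‖ ≤ δc →
          measH T (fun k => H k - h xs us) ≤ Eh →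
          N * ℓ xs us - |2 * Λ + T * M| ≤ Jstar f ℓ h Z T N x H ∧
          Jstar f ℓ h Z T N x H ≤ N * ℓ xs us + |B| := by
        intro x H hH hx hHE
        obtain ⟨hu, hcu, -⟩ := hopt N x (hX x H hx hHE) H hH
        have h1 := hlow N x H _ (by omega) hu
        have h2 := Finset.sum_nonneg (s := Finset.range ((N - 1) / T * T))
          fun k _ => hρ0 x (ustar N x H) k
        have h3 := hB N x H hH hx hHE
        have h4 := le_abs_self B
        have h5 := le_abs_self (2 * Λ + T * M)
        constructor <;> linarith
      obtain ⟨a1, a2⟩ := hb x H hH (hx.trans hδ') (hmE.trans hE')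
      obtain ⟨b1, b2⟩ := hb xs _ hHs (by rw [sub_self, norm_zero]; exact hδc.le)
        (by rw [hm0]; exact hEh.le)
      have h3 : C ≤ (C / r₀ + 1) * (δ + E) := by
        have : C / r₀ * r₀ ≤ C / r₀ * (δ + E) :=
          mul_le_mul_of_nonneg_left hbig.le (by positivity)
        rw [div_mul_cancel₀ _ hr₀.ne'] at this
        linarith
      rw [abs_le]
      constructor <;> linarith

end EMPC
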